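/- Let q0, qx, qy, qxy ∈ ℝ², v(i,j) = q0 + i·qx + j·qy + (i·j)·qxy, and for integers i,j let r_{ij}(ξ,η) = v(i,j)·Φ₋₁,₋₁(ξ,η) + v(i+1,j)·Φ₁,₋₁(ξ,η) + v(i+1,j+1)·Φ₁,₁(ξ,η) + v(i,j+1)·Φ₋₁,₁(ξ,η) with Jacobian matrix J^{(i,j)}(ξ,η). Then the (i,j)-dependence of the Jacobian is a rank-one update that is independent of (ξ,η): for all integers i,j and all (ξ,η), J^{(i,j)}(ξ,η) = J^{(0,0)}(ξ,η) + (1/2)·qxy·(j, i), where qxy·(j, i) denotes the 2×2 outer-product matrix whose first column is j·qxy and whose second column is i·qxy. -/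

import Mathlib

noncomputable section

/-- Bilinear Lagrange shape function on `[-1,1]²` associated with corner `(sx, sy)`,
where `sx, sy ∈ {-1, 1}`:  `Φ_{sx,sy}(ξ,η) = (1 + sx·ξ)(1 + sy·η)/4`. -/
def Phi (sx sy ξ η : ℝ) : ℝ := (1 + sx * ξ) * (1 + sy * η) / 4

/-- The vertex family `v(i,j) = q0 + i·qx + j·qy + (i·j)·qxy`. -/
def vtx (q0 qx qy qxy : Fin 2 → ℝ) (i j : ℝ) : Fin 2 → ℝ :=
  q0 + i • qx + j • qy + (i * j) • qxy

/-- The bilinear map `r_{ij}(ξ,η)` interpolating the four vertices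
`v(i,j), v(i+1,j), v(i+1,j+1), v(i,j+1)` with the shape functions. -/
def rmap (q0 qx qy qxy : Fin 2 → ℝ) (i j : ℤ) (ξ η : ℝ) : Fin 2 → ℝ :=
  Phi (-1) (-1) ξ η • vtx q0 qx qy qxy (i : ℝ) (j : ℝ)
    + Phi 1 (-1) ξ η • vtx q0 qx qy qxy ((i : ℝ) + 1) (j : ℝ)
    + Phi 1 1 ξ η • vtx q0 qx qy qxy ((i : ℝ) + 1) ((j : ℝ) + 1)
    + Phi (-1) 1 ξ η • vtx q0 qx qy qxy (i : ℝ) ((j : ℝ) + 1)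

/-- The `2×2` Jacobian matrix of `r_{ij}` at `(ξ,η)`: first column is the partial
derivative with respect to `ξ`, second column with respect to `η`. -/
def Jac (q0 qx qy qxy : Fin 2 → ℝ) (i j : ℤ) (ξ η : ℝ) : Matrix (Fin 2) (Fin 2) ℝ :=
  Matrix.of fun a b : Fin 2 =>
    if b = 0 then deriv (fun t => rmap q0 qx qy qxy i j t η a) ξ
    else deriv (fun t => rmap q0 qx qy qxy i j ξ t a) η


/-- A bilinear element evaluated at `(ξ, η)` is the vertex family at the shifted index
`(i + (1 + ξ) / 2, j + (1 + η) / 2)`. -/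
theorem rmap_eq_vtx (q0 qx qy qxy : Fin 2 → ℝ) (i j : ℤ) (ξ η : ℝ) :
    rmap q0 qx qy qxy i j ξ η = vtx q0 qx qy qxy (i + (1 + ξ) / 2) (j + (1 + η) / 2) := by
  ext a
  simp only [rmap, vtx, Phi, Pi.add_apply, Pi.smul_apply, smul_eq_mul]
  ring

theorem hasDerivAt_rmap_fst (q0 qx qy qxy : Fin 2 → ℝ) (i j : ℤ) (ξ η : ℝ) (a : Fin 2) :
    HasDerivAt (fun t => rmap q0 qx qy qxy i j t η a)
      ((qx a + (j + (1 + η) / 2) * qxy a) / 2) ξ := by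
  have h := ((hasDerivAt_id ξ).mul_const ((qx a + (j + (1 + η) / 2) * qxy a) / 2)).const_add
    (q0 a + (i + 1 / 2) * qx a + (j + (1 + η) / 2) * qy a
      + (i + 1 / 2) * (j + (1 + η) / 2) * qxy a)
  refine (h.congr_deriv (one_mul _)).congr_of_eventuallyEq (.of_forall fun t => ?_)
  simp only [rmap_eq_vtx, vtx, Pi.add_apply, Pi.smul_apply, smul_eq_mul, id]
  ring

theorem hasDerivAt_rmap_snd (q0 qx qy qxy : Fin 2 → ℝ) (i j : ℤ) (ξ η : ℝ) (a : Fin 2) :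
    HasDerivAt (fun t => rmap q0 qx qy qxy i j ξ t a)
      ((qy a + (i + (1 + ξ) / 2) * qxy a) / 2) η := by
  have h := ((hasDerivAt_id η).mul_const ((qy a + (i + (1 + ξ) / 2) * qxy a) / 2)).const_add
    (q0 a + (i + (1 + ξ) / 2) * qx a + (j + 1 / 2) * qy a
      + (i + (1 + ξ) / 2) * (j + 1 / 2) * qxy a)
  refine (h.congr_deriv (one_mul _)).congr_of_eventuallyEq (.of_forall fun t => ?_)
  simp only [rmap_eq_vtx, vtx, Pi.add_apply, Pi.smul_apply, smul_eq_mul, id]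
  ring

/-- The `(i,j)`-dependence of the Jacobian is a rank-one update independent of `(ξ,η)`:
`J^{(i,j)}(ξ,η) = J^{(0,0)}(ξ,η) + (1/2)·qxy·(j, i)`, where `qxy·(j, i)` is the
outer-product matrix whose first column is `j·qxy` and whose second column is `i·qxy`. -/
theorem jacobian_rank_one_update (q0 qx qy qxy : Fin 2 → ℝ) (i j : ℤ) (ξ η : ℝ) :
    Jac q0 qx qy qxy i j ξ η =
      Jac q0 qx qy qxy 0 0 ξ η
        + (1 / 2 : ℝ) •
          Matrix.of (fun a b : Fin 2 => qxy a * (if b = 0 then (j : ℝ) else (i : ℝ))) := by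
  ext a b
  simp only [Jac, Matrix.add_apply, Matrix.smul_apply, Matrix.of_apply, smul_eq_mul,
    (hasDerivAt_rmap_fst q0 qx qy qxy _ _ ξ η a).deriv,
    (hasDerivAt_rmap_snd q0 qx qy qxy _ _ ξ η a).deriv]
  split_ifs <;> push_cast <;> ring

end
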